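/- With respect to the inner product on Kreimer's Hopf algebra H_K given by (u₁,u₂) = (B₊(u₁), B₊(u₂)), the adjoint of the pruning derivation P is N + M_•, where M_• is the operator of multiplication by •; that is, for all u, v ∈ H_K, (N(u) + •·u, v) = (u, P(v)). -/

import Mathlib

attribute [local instance] Classical.propDecidable

inductive PlanarTree : Type where
  | node : List PlanarTree → PlanarTree

namespace PlanarTree

/-- Isomorphism of (planar representatives of) rooted trees: the lists of
principal branches match up, pairwise isomorphically, after a permutation. -/
inductive Iso : PlanarTree → PlanarTree → Prop where
  | node {l m l' : List PlanarTree} :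
      List.Perm l m → List.Forall₂ Iso m l' → Iso (node l) (node l')

/-- Number of vertices. -/
def size : PlanarTree → ℕ
  | node l => 1 + (l.attach.map fun c => size c.1).sum
decreasing_by simp only [PlanarTree.node.sizeOf_spec]; exact Nat.lt_of_lt_of_le (List.sizeOf_lt_of_mem c.2) (Nat.le_add_left _ _)

mutual
  /-- All trees obtained by attaching the root of `s` by a new edge to some vertex. -/
  def graftList (s : PlanarTree) : PlanarTree → List PlanarTree
    | node l => node (s :: l) :: (graftAux s l).map node
  def graftAux (s : PlanarTree) : List PlanarTree → List (List PlanarTree)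
    | [] => []
    | a :: l => ((graftList s a).map (· :: l)) ++ (graftAux s l).map (a :: ·)
end

/-- All trees obtained by adding a new edge and terminal vertex at some vertex. -/
def growList (t : PlanarTree) : List PlanarTree := graftList (node []) t

mutual
  /-- All trees obtained by deleting one (non-root) terminal vertex. -/
  def pruneList : PlanarTree → List PlanarTree
    | node l => (pruneAux l).map node
  def pruneAux : List PlanarTree → List (List PlanarTree)
    | [] => []
    | a :: l =>
        (match a with | node [] => [l] | _ => []) ++
        ((pruneList a).map (· :: l)) ++ (pruneAux l).map (a :: ·)
end

mutual
  /-- All pairs (cut-off subtree, remaining tree) obtained by cutting one edge. -/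
  def cutPairs : PlanarTree → List (PlanarTree × PlanarTree)
    | node l => (cutAux l).map fun x => (x.1, node x.2)
  def cutAux : List PlanarTree → List (PlanarTree × List PlanarTree)
    | [] => []
    | a :: l =>
        (a, l) :: (((cutPairs a).map fun x => (x.1, x.2 :: l)) ++
          (cutAux l).map fun x => (x.1, a :: x.2))
end

/-- The order of the symmetry group `SG(t)`: the product over all vertices `v`
of the number of permutations of the branches at `v` exchanging isomorphic branches. -/
noncomputable def sg : PlanarTree → ℕ
  | node l =>
      (l.attach.map fun c => sg c.1).prod *
        Nat.card {σ : Equiv.Perm (Fin l.length) // ∀ i, Iso (l.get (σ i)) (l.get i)}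
decreasing_by simp only [PlanarTree.node.sizeOf_spec]; exact Nat.lt_of_lt_of_le (List.sizeOf_lt_of_mem c.2) (Nat.le_add_left _ _)

/-- Vertices of a planar tree, encoded as paths of child-indices from the root. -/
inductive IsVertex : PlanarTree → List ℕ → Prop where
  | root (t : PlanarTree) : IsVertex t []
  | child {l : List PlanarTree} {i : ℕ} {c : PlanarTree} {p : List ℕ} :
      l[i]? = some c → IsVertex c p → IsVertex (node l) (i :: p)

def Vertex (t : PlanarTree) : Type := {p : List ℕ // IsVertex t p}

/-- `v` lies strictly below `w` in the tree order (i.e. `w` is a proper ancestor of `v`). -/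
def StrictBelow {t : PlanarTree} (v w : Vertex t) : Prop := w.1 <+: v.1 ∧ w.1 ≠ v.1

/-- A labelling of `t`. -/
def Labelling (t : PlanarTree) : Type :=
  {f : Vertex t ≃ Fin t.size // ∀ v w, StrictBelow v w → f w < f v}

/-- Equivalence of labellings: they differ by an automorphism of the rooted tree. -/
def labelEquiv {t : PlanarTree} (f g : Labelling t) : Prop :=
  ∃ φ : Equiv.Perm (Vertex t),
    (∀ v w, StrictBelow (φ v) (φ w) ↔ StrictBelow v w) ∧ ∀ v, f.1 (φ v) = g.1 v

end PlanarTree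

/-- Rooted trees: isomorphism classes of planar rooted trees. -/
instance planarSetoid : Setoid PlanarTree := Relation.EqvGen.setoid PlanarTree.Iso

def RTree : Type := Quotient planarSetoid

namespace RTree

def mk (p : PlanarTree) : RTree := ⟦p⟧

/-- A chosen planar representative. -/
noncomputable def rep (T : RTree) : PlanarTree := Quotient.out T

noncomputable def size (T : RTree) : ℕ := T.rep.size

/-- The order of the symmetry (automorphism) group of `T`. -/
noncomputable def sg (T : RTree) : ℕ := T.rep.sg

/-- The one-vertex tree. -/
def bullet : RTree := mk (PlanarTree.node [])

/-- `Covers T T'` means `T ⊲ T'`: `T` is obtained from `T'` by deleting one terminal vertex. -/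
noncomputable def Covers (T T' : RTree) : Prop :=
  ∃ p ∈ T'.rep.pruneList, mk p = T

/-- `n(T;T')`: the number of vertices of `T` to which a new edge can be added to obtain `T'`. -/
noncomputable def nCov (T T' : RTree) : ℕ :=
  T.rep.growList.countP fun p => decide (mk p = T')

/-- `m(T;T')`: the number of (terminal) edges of `T'` which when removed leave `T`. -/
noncomputable def mCov (T T' : RTree) : ℕ :=
  T'.rep.pruneList.countP fun p => decide (mk p = T)

/-- `n(T₁,T₂;T₃)`: the number of vertices of `T₂` such that attaching the root of `T₁`
there by a new edge yields `T₃`. -/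
noncomputable def nTri (T₁ T₂ T₃ : RTree) : ℕ :=
  (PlanarTree.graftList T₁.rep T₂.rep).countP fun p => decide (mk p = T₃)

/-- `m(T₁,T₂;T₃)`: the number of edges of `T₃` whose removal cuts off a subtree
isomorphic to `T₁` leaving `T₂` (the piece containing the root). -/
noncomputable def mTri (T₁ T₂ T₃ : RTree) : ℕ :=
  T₃.rep.cutPairs.countP fun x => decide (mk x.1 = T₁ ∧ mk x.2 = T₂)

end RTree

section Ops

variable (k : Type*) [Semiring k]

/-- The element `𝔑(T) = Σ_{T ⊲ T'} n(T;T')·T'` of `k{T}`. -/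
noncomputable def growF (T : RTree) : RTree →₀ k :=
  (T.rep.growList.map fun p => Finsupp.single (RTree.mk p) (1 : k)).sum

/-- The element `𝔓(T) = Σ_{T' ⊲ T} m(T';T)·T'` of `k{T}`. -/
noncomputable def pruneF (T : RTree) : RTree →₀ k :=
  (T.rep.pruneList.map fun p => Finsupp.single (RTree.mk p) (1 : k)).sum

/-- The growth operator `𝔑` on `k{T}`. -/
noncomputable def Grow : Module.End k (RTree →₀ k) :=
  Finsupp.linearCombination k (growF k)

/-- The pruning operator `𝔓` on `k{T}`. -/
noncomputable def Prune : Module.End k (RTree →₀ k) :=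
  Finsupp.linearCombination k (pruneF k)

/-- The operator `𝔇` on `k{T}`, `𝔇(t) = |t|·t`. -/
noncomputable def Diag : Module.End k (RTree →₀ k) :=
  Finsupp.linearCombination k fun T => (T.size : k) • Finsupp.single T 1

/-- The inner product on `k{T}` determined by `(t,t') = |SG(t)|·δ_{t,t'}`. -/
noncomputable def innerT (x y : RTree →₀ k) : k :=
  x.sum fun T c => c * y T * (T.sg : k)

/-- Generalized multiplicity `n(T;T')`: coefficient of `T'` in `𝔑^{|T'|-|T|}(T)`. -/
noncomputable def nGen (T T' : RTree) : k :=
  ((Grow k ^ (T'.size - T.size)) (Finsupp.single T 1)) T'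

/-- Generalized multiplicity `m(T;T')`: coefficient of `T` in `𝔓^{|T'|-|T|}(T')`. -/
noncomputable def mGen (T T' : RTree) : k :=
  ((Prune k ^ (T'.size - T.size)) (Finsupp.single T' 1)) T

end Ops

section Kreimer

variable (k : Type*) [CommSemiring k]

/-- Kreimer's Hopf algebra `H_K`, as a commutative algebra: the free polynomial
algebra on rooted trees. -/
abbrev HK := MvPolynomial RTree k

/-- The inclusion `k{T} → H_K` of the linear span of the variables. -/
noncomputable def toHK : (RTree →₀ k) →ₗ[k] HK k :=
  Finsupp.linearCombination k fun T => MvPolynomial.X T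

/-- The growth derivation `N` on `H_K`, with `N(t) = 𝔑(t)` for rooted trees `t`. -/
noncomputable def ND : Derivation k (HK k) (HK k) :=
  MvPolynomial.mkDerivation k fun T => toHK k (growF k T)

/-- The pruning derivation `P` on `H_K`, with `P(t) = 𝔓(t)` for `|t| ≥ 2`, `P(•) = 1`. -/
noncomputable def PD : Derivation k (HK k) (HK k) :=
  MvPolynomial.mkDerivation k fun T =>
    if T = RTree.bullet then 1 else toHK k (pruneF k T)

/-- The grading derivation `D` on `H_K`, multiplying each homogeneous element of
degree `n` by `n`; it is the derivation with `D(t) = |t|·t` for rooted trees `t`. -/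
noncomputable def DD : Derivation k (HK k) (HK k) :=
  MvPolynomial.mkDerivation k fun T => (T.size : k) • MvPolynomial.X T

/-- The map `B₊ : H_K → k{T}` sending a forest to the tree obtained by attaching
all its roots to a new root vertex. -/
noncomputable def forestTree (d : RTree →₀ ℕ) : RTree :=
  RTree.mk (PlanarTree.node
    (d.support.toList.flatMap fun T => List.replicate (d T) T.rep))

noncomputable def Bplus (p : HK k) : RTree →₀ k :=
  ∑ d ∈ p.support, Finsupp.single (forestTree d) (MvPolynomial.coeff d p)

/-- The inner product on `H_K`. -/
noncomputable def innerHK (u v : HK k) : k := innerT k (Bplus k u) (Bplus k v)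

/-- The degree-`n` homogeneous component of `H_K`. -/
noncomputable abbrev HKcomp (n : ℕ) : Submodule k (HK k) :=
  MvPolynomial.weightedHomogeneousSubmodule k (fun T : RTree => T.size) n

/-- `T_i`: the number of rooted trees with `i+1` vertices. -/
noncomputable def Tcard (i : ℕ) : ℕ := Nat.card {T : RTree // T.size = i + 1}

end Kreimer

namespace PlanarTree

theorem induction_children {motive : PlanarTree → Prop}
    (h : ∀ l, (∀ a ∈ l, motive a) → motive (node l)) (p : PlanarTree) : motive p :=
  PlanarTree.rec (motive_1 := motive) (motive_2 := fun l => ∀ a ∈ l, motive a)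
    h (by simp) (fun _ _ ha hl => by simpa using ⟨ha, hl⟩) p

theorem mk_eq_of_iso {p q : PlanarTree} (h : Iso p q) : RTree.mk p = RTree.mk q :=
  Quotient.sound (Relation.EqvGen.rel _ _ h)

theorem Iso.refl (p : PlanarTree) : Iso p p := by
  induction p using induction_children with
  | h l ih =>
    refine Iso.node (List.Perm.refl l) ?_
    induction l with
    | nil => exact .nil
    | cons a l ihl =>
      exact .cons (ih a (by simp)) (ihl fun b hb => ih b (by simp [hb]))

theorem map_mk_perm_of_mk_eq {l l' : List PlanarTree}
    (h : RTree.mk (node l) = RTree.mk (node l')) :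
    List.Perm (l.map RTree.mk) (l'.map RTree.mk) := by
  have key : ∀ p q, Relation.EqvGen Iso p q → ∀ l l', p = node l → q = node l' →
      List.Perm (l.map RTree.mk) (l'.map RTree.mk) := by
    intro p q hpq
    induction hpq with
    | rel p q h =>
      rintro _ _ rfl rfl
      cases h with
      | node hp hf =>
        refine (hp.map _).trans (List.Perm.of_eq ?_)
        clear hp
        induction hf with
        | nil => rfl
        | cons h _ ih => simp [mk_eq_of_iso h, ih]
    | refl p =>
      rintro _ _ rfl h
      cases h
      exact List.Perm.refl _
    | symm p q _ ih => exact fun l l' h h' => (ih l' l h' h).symm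
    | trans p q r _ _ ih ih' =>
      cases q with
      | node m => exact fun l l' h h' => (ih l m h rfl).trans (ih' m l' rfl h')
  exact key _ _ (Quotient.exact h) _ _ rfl rfl

theorem exists_perm_map_mk_eq {l l' : List PlanarTree}
    (h : List.Perm (l.map RTree.mk) (l'.map RTree.mk)) :
    ∃ m, List.Perm l m ∧ m.map RTree.mk = l'.map RTree.mk := by
  have key := congrFun (congrFun (List.eq_map_comp_perm RTree.mk) (l'.map RTree.mk)) l
  obtain ⟨m, hm, hp⟩ := key.mpr h.symm
  exact ⟨m, hp.symm, hm.symm⟩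

theorem iso_iff_mk_eq {p q : PlanarTree} : Iso p q ↔ RTree.mk p = RTree.mk q := by
  refine ⟨mk_eq_of_iso, ?_⟩
  induction p using induction_children generalizing q with
  | h l ih =>
    cases q with
    | node l' =>
      intro h
      obtain ⟨m, hm, he⟩ := exists_perm_map_mk_eq (map_mk_perm_of_mk_eq h)
      refine Iso.node hm ?_
      replace ih : ∀ a ∈ m, ∀ {q}, RTree.mk a = RTree.mk q → Iso a q :=
        fun a ha => ih a (hm.mem_iff.mpr ha)
      clear h hm
      induction m generalizing l' with
      | nil =>
        cases l' with
        | nil => exact .nil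
        | cons _ _ => simp at he
      | cons a m ihm =>
        cases l' with
        | nil => simp at he
        | cons b l' =>
          simp only [List.map_cons, List.cons.injEq] at he
          exact .cons (ih a (by simp) he.1) (ihm l' he.2 fun c hc => ih c (by simp [hc]))

theorem mk_node_eq_iff {l l' : List PlanarTree} :
    RTree.mk (node l) = RTree.mk (node l') ↔
      List.Perm (l.map RTree.mk) (l'.map RTree.mk) := by
  refine ⟨map_mk_perm_of_mk_eq, fun h => ?_⟩
  obtain ⟨m, hm, he⟩ := exists_perm_map_mk_eq h
  refine mk_eq_of_iso (Iso.node hm ?_)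
  rw [← List.forall₂_eq_eq_eq, List.forall₂_map_left_iff, List.forall₂_map_right_iff] at he
  exact he.imp fun _ _ => iso_iff_mk_eq.mpr

/-- A function on planar trees that is computed from the isomorphism classes of the principal
branches and its values on them, regardless of their order, is an isomorphism invariant. -/
theorem invariant_of_perm {α : Type*} (F : PlanarTree → α)
    (hF : ∀ l l' : List PlanarTree,
      List.Perm (l.map fun a => (RTree.mk a, F a)) (l'.map fun a => (RTree.mk a, F a)) →
        F (node l) = F (node l'))
    {p q : PlanarTree} (h : RTree.mk p = RTree.mk q) : F p = F q := by
  induction p using induction_children generalizing q with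
  | h l ih =>
    cases q with
    | node l' =>
      obtain ⟨m, hm, he⟩ := exists_perm_map_mk_eq (map_mk_perm_of_mk_eq h)
      refine hF _ _ ((hm.map _).trans (List.Perm.of_eq ?_))
      rw [← List.forall₂_eq_eq_eq, List.forall₂_map_left_iff, List.forall₂_map_right_iff] at he ⊢
      have hmem : ∀ a ∈ m, a ∈ l := fun a ha => hm.mem_iff.mpr ha
      clear h hm
      induction he with
      | nil => exact .nil
      | cons hab _ ihf =>
        exact .cons (by rw [hab, ih _ (hmem _ (by simp)) hab])
          (ihf fun c hc => hmem c (by simp [hc]))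

theorem sg_node (l : List PlanarTree) : (node l).sg = (l.map sg).prod *
    ∏ T ∈ (l.map RTree.mk : Multiset RTree).toFinset,
      ((l.map RTree.mk : Multiset RTree).count T).factorial := by
  rw [sg, List.attach_map_val (f := sg)]
  congr 1
  let f : Fin l.length → RTree := fun i => RTree.mk (l.get i)
  have hl : (l.map RTree.mk : Multiset RTree) = Finset.univ.val.map f := by
    have : l.map RTree.mk = List.ofFn f := by
      conv_lhs => rw [← List.ofFn_get l, List.map_ofFn]
      rfl
    rw [this, List.ofFn_eq_map]
    rfl
  have hc : Nat.card {σ : Equiv.Perm (Fin l.length) // ∀ i, Iso (l.get (σ i)) (l.get i)} =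
      Fintype.card {σ : Equiv.Perm (Fin l.length) // f ∘ σ = f} := by
    rw [← Nat.card_eq_fintype_card]
    refine Nat.card_congr (Equiv.subtypeEquivRight fun σ => ?_)
    simp only [iso_iff_mk_eq, funext_iff, Function.comp_apply, f]
  rw [hc, DomMulAct.stabilizer_card' f, hl]
  refine Finset.prod_congr ?_ fun T _ => ?_
  · ext T
    simp
  · rw [Multiset.count_map, Fintype.card_subtype]
    congr 1
    simp only [Finset.card_def, Finset.filter_val, eq_comm]

theorem sg_eq_of_mk_eq {p q : PlanarTree} (h : RTree.mk p = RTree.mk q) : p.sg = q.sg := by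
  refine invariant_of_perm sg (fun l l' hl => ?_) h
  have h1 : List.Perm (l.map RTree.mk) (l'.map RTree.mk) := by
    simpa [Function.comp_def] using hl.map Prod.fst
  have h2 : List.Perm (l.map sg) (l'.map sg) := by
    simpa [Function.comp_def] using hl.map Prod.snd
  rw [sg_node, sg_node, h2.prod_eq, Multiset.coe_eq_coe.mpr h1]

end PlanarTree

namespace RTree

theorem mk_rep (T : RTree) : mk T.rep = T := Quotient.out_eq T

theorem sg_mk (p : PlanarTree) : (mk p).sg = p.sg :=
  PlanarTree.sg_eq_of_mk_eq (mk_rep _)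

theorem sg_mk_node (l : List PlanarTree) : (mk (PlanarTree.node l)).sg =
    ((l.map mk : Multiset RTree).map sg).prod *
      ∏ T ∈ (l.map mk : Multiset RTree).toFinset, ((l.map mk : Multiset RTree).count T).factorial := by
  rw [sg_mk, PlanarTree.sg_node]
  simp [Function.comp_def, sg_mk]

theorem sg_bullet : bullet.sg = 1 := by
  simp [bullet, sg_mk_node]

end RTree

theorem map_mk_branches (d : RTree →₀ ℕ) :
    (((d.support.toList.flatMap fun T => List.replicate (d T) T.rep).map RTree.mk :
      List RTree) : Multiset RTree) = Finsupp.toMultiset d := by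
  rw [List.map_flatMap]
  simp only [List.map_replicate, RTree.mk_rep, ← Multiset.coe_bind, Finset.coe_toList,
    Multiset.coe_replicate]
  simp [Finsupp.toMultiset_apply, Finsupp.sum, Multiset.bind, Multiset.join,
    Multiset.nsmul_singleton]

theorem forestTree_eq_iff {d : RTree →₀ ℕ} {l : List PlanarTree} :
    forestTree d = RTree.mk (PlanarTree.node l) ↔
      Finsupp.toMultiset d = (l.map RTree.mk : Multiset RTree) := by
  rw [forestTree, PlanarTree.mk_node_eq_iff, ← Multiset.coe_eq_coe, map_mk_branches]

theorem forestTree_injective : Function.Injective forestTree := by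
  intro d e h
  rw [forestTree.eq_def e, forestTree_eq_iff, map_mk_branches] at h
  exact Multiset.toFinsupp.symm.injective h

theorem sg_forestTree (d : RTree →₀ ℕ) : (forestTree d).sg =
    ((Finsupp.toMultiset d).map RTree.sg).prod *
      ∏ T ∈ (Finsupp.toMultiset d).toFinset, ((Finsupp.toMultiset d).count T).factorial := by
  rw [forestTree, RTree.sg_mk_node, map_mk_branches]

theorem sg_forestTree_add_single (d : RTree →₀ ℕ) (T : RTree) :
    (forestTree (d + Finsupp.single T 1)).sg = T.sg * (d T + 1) * (forestTree d).sg := by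
  have extend : ∀ e : RTree →₀ ℕ, e.support ⊆ insert T d.support →
      ∏ S ∈ (Finsupp.toMultiset e).toFinset, ((Finsupp.toMultiset e).count S).factorial =
        (e T).factorial * ∏ S ∈ (insert T d.support).erase T, (e S).factorial := by
    intro e he
    rw [Finset.mul_prod_erase _ (fun S => (e S).factorial) (Finset.mem_insert_self _ _)]
    simp only [Finsupp.toFinset_toMultiset, Finsupp.count_toMultiset]
    exact Finset.prod_subset he fun S _ hS => by simp [Finsupp.notMem_support_iff.mp hS]
  rw [sg_forestTree, sg_forestTree, extend d (Finset.subset_insert _ _), extend]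
  · have : ∀ S ∈ (insert T d.support).erase T,
        ((d + Finsupp.single T 1 : RTree →₀ ℕ) S).factorial = (d S).factorial := fun S hS => by
      simp [Finsupp.single_eq_of_ne (Finset.ne_of_mem_erase hS)]
    rw [Finset.prod_congr rfl this]
    simp [Finsupp.toMultiset_add, Nat.factorial_succ]
    ring
  · refine Finsupp.support_add.trans (Finset.union_subset (Finset.subset_insert _ _) ?_)
    exact Finsupp.support_single_subset.trans (by simp)

section Adjoint

variable (k : Type*) [Field k]

/-- The formal sum in `k{T}` of a list of trees. -/
noncomputable def treeSum (L : List PlanarTree) : RTree →₀ k :=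
  (L.map fun p => Finsupp.single (RTree.mk p) (1 : k)).sum

/-- The monomial in `H_K` of a forest. -/
noncomputable def forestMonomial (l : List PlanarTree) : HK k :=
  (l.map fun a => MvPolynomial.X (RTree.mk a)).prod

/-- The formal sum in `H_K` of a list of forests. -/
noncomputable def forestSum (L : List (List PlanarTree)) : HK k :=
  (L.map (forestMonomial k)).sum

/-- `Bplus` as a linear map. -/
noncomputable def bplusLinear : HK k →ₗ[k] (RTree →₀ k) :=
  Finsupp.lmapDomain k k forestTree ∘ₗ (MvPolynomial.basisMonomials RTree k).repr.toLinearMap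

theorem basisMonomials_repr_apply (p : HK k) (d : RTree →₀ ℕ) :
    (MvPolynomial.basisMonomials RTree k).repr p d = MvPolynomial.coeff d p := rfl

theorem basisMonomials_repr_monomial (d : RTree →₀ ℕ) (a : k) :
    (MvPolynomial.basisMonomials RTree k).repr (MvPolynomial.monomial d a) =
      Finsupp.single d a := by
  ext e
  rw [basisMonomials_repr_apply, MvPolynomial.coeff_monomial, Finsupp.single_apply]

theorem Bplus_eq (p : HK k) : Bplus k p = bplusLinear k p := by
  change _ = Finsupp.mapDomain forestTree ((MvPolynomial.basisMonomials RTree k).repr p)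
  rw [Finsupp.mapDomain, Finsupp.sum, Bplus]
  rfl

theorem bplusLinear_apply_forestTree (p : HK k) (d : RTree →₀ ℕ) :
    bplusLinear k p (forestTree d) = MvPolynomial.coeff d p :=
  Finsupp.mapDomain_apply forestTree_injective _ _

theorem bplusLinear_monomial (d : RTree →₀ ℕ) (a : k) :
    bplusLinear k (MvPolynomial.monomial d a) = Finsupp.single (forestTree d) a := by
  simp [bplusLinear, basisMonomials_repr_monomial, Finsupp.mapDomain_single]

theorem forestMonomial_eq_monomial (l : List PlanarTree) : forestMonomial k l =
    MvPolynomial.monomial (Multiset.toFinsupp (l.map RTree.mk : Multiset RTree)) 1 := by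
  induction l with
  | nil => simp [forestMonomial]
  | cons a l ih =>
    rw [forestMonomial] at ih ⊢
    rw [List.map_cons, List.prod_cons, ih, List.map_cons, ← Multiset.cons_coe,
      ← Multiset.singleton_add, map_add, Multiset.toFinsupp_singleton, MvPolynomial.X,
      MvPolynomial.monomial_mul, one_mul]

theorem bplusLinear_forestMonomial (l : List PlanarTree) :
    bplusLinear k (forestMonomial k l) = Finsupp.single (RTree.mk (.node l)) 1 := by
  rw [forestMonomial_eq_monomial, bplusLinear_monomial, forestTree_eq_iff.mpr]
  simp

theorem bplusLinear_forestSum (L : List (List PlanarTree)) :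
    bplusLinear k (forestSum k L) = treeSum k (L.map .node) := by
  simp [forestSum, treeSum, map_list_sum, Function.comp_def, bplusLinear_forestMonomial]

theorem forestMonomial_cons (a : PlanarTree) (l : List PlanarTree) :
    forestMonomial k (a :: l) = MvPolynomial.X (RTree.mk a) * forestMonomial k l := by
  simp [forestMonomial]

theorem forestSum_map_cons (a : PlanarTree) (L : List (List PlanarTree)) :
    forestSum k (L.map (a :: ·)) = MvPolynomial.X (RTree.mk a) * forestSum k L := by
  simp [forestSum, Function.comp_def, forestMonomial_cons, List.sum_map_mul_left]

theorem toHK_treeSum_mul (L : List PlanarTree) (l : List PlanarTree) :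
    forestSum k (L.map (· :: l)) = toHK k (treeSum k L) * forestMonomial k l := by
  simp [forestSum, treeSum, toHK, Function.comp_def, forestMonomial_cons, List.sum_map_mul_right,
    map_list_sum]

theorem forestSum_append (L M : List (List PlanarTree)) :
    forestSum k (L ++ M) = forestSum k L + forestSum k M := by
  simp [forestSum]

theorem forestMonomial_perm {l l' : List PlanarTree}
    (h : List.Perm (l.map RTree.mk) (l'.map RTree.mk)) :
    forestMonomial k l = forestMonomial k l' := by
  rw [forestMonomial_eq_monomial, forestMonomial_eq_monomial, Multiset.coe_eq_coe.mpr h]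

/-- A function on forests obeying the Leibniz rule with respect to values `g` on trees depends
only on the multiset of trees paired with these values. -/
theorem leibniz_perm {A : List PlanarTree → HK k} {g : PlanarTree → HK k} (hnil : A [] = 0)
    (hcons : ∀ a l, A (a :: l) = g a * forestMonomial k l + MvPolynomial.X (RTree.mk a) * A l)
    {l l' : List PlanarTree}
    (h : List.Perm (l.map fun a => (RTree.mk a, g a)) (l'.map fun a => (RTree.mk a, g a))) :
    A l = A l' := by
  let ι : RTree × HK k → TrivSqZeroExt (HK k) (HK k) :=
    fun x => TrivSqZeroExt.inl (MvPolynomial.X x.1) + TrivSqZeroExt.inr x.2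
  have key : ∀ l : List PlanarTree, (l.map fun a => ι (RTree.mk a, g a)).prod =
      TrivSqZeroExt.inl (forestMonomial k l) + TrivSqZeroExt.inr (A l) := by
    intro l
    induction l with
    | nil => simp [hnil, forestMonomial]
    | cons a l ih =>
      rw [List.map_cons, List.prod_cons, ih]
      ext
      · simp [ι, forestMonomial_cons]
      · simp [ι, hcons, mul_comm, add_comm]
  have := (h.map ι).prod_eq
  simp only [List.map_map, Function.comp_def, key] at this
  simpa using congrArg TrivSqZeroExt.snd this

theorem leibniz_eq_derivation {A : List PlanarTree → HK k} {g : PlanarTree → HK k}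
    (hnil : A [] = 0)
    (hcons : ∀ a l, A (a :: l) = g a * forestMonomial k l + MvPolynomial.X (RTree.mk a) * A l)
    (D : Derivation k (HK k) (HK k)) (hD : ∀ a, D (MvPolynomial.X (RTree.mk a)) = g a)
    (l : List PlanarTree) : A l = D (forestMonomial k l) := by
  induction l with
  | nil => simp [hnil, forestMonomial]
  | cons a l ih =>
    rw [hcons, forestMonomial_cons, Derivation.leibniz, hD, ih, smul_eq_mul, smul_eq_mul]
    ring

theorem forestSum_graftAux_cons (a : PlanarTree) (l : List PlanarTree) :
    forestSum k (PlanarTree.graftAux (.node []) (a :: l)) =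
      toHK k (treeSum k a.growList) * forestMonomial k l +
        MvPolynomial.X (RTree.mk a) * forestSum k (PlanarTree.graftAux (.node []) l) := by
  rw [PlanarTree.graftAux, forestSum_append, toHK_treeSum_mul, forestSum_map_cons,
    PlanarTree.growList]

theorem treeSum_growList_node (l : List PlanarTree) :
    treeSum k (PlanarTree.node l).growList = bplusLinear k
      (MvPolynomial.X RTree.bullet * forestMonomial k l +
        forestSum k (PlanarTree.graftAux (.node []) l)) := by
  rw [PlanarTree.growList, PlanarTree.graftList, map_add, RTree.bullet, ← forestMonomial_cons,
    bplusLinear_forestMonomial, bplusLinear_forestSum]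
  simp [treeSum]

theorem growF_mk (p : PlanarTree) : growF k (RTree.mk p) = treeSum k p.growList := by
  refine PlanarTree.invariant_of_perm (fun p => treeSum k p.growList) (fun l l' h => ?_)
    (RTree.mk_rep (RTree.mk p))
  have hm : forestMonomial k l = forestMonomial k l' :=
    forestMonomial_perm k (by simpa [Function.comp_def] using h.map Prod.fst)
  have hA := leibniz_perm k (A := fun l => forestSum k (PlanarTree.graftAux (.node []) l))
    (by simp [PlanarTree.graftAux, forestSum]) (forestSum_graftAux_cons k)
    (by simpa [Function.comp_def] using h.map (Prod.map id (toHK k)))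
  simp only [treeSum_growList_node, hm, hA]

theorem growF_mk_node (l : List PlanarTree) : growF k (RTree.mk (.node l)) =
    bplusLinear k (ND k (forestMonomial k l) +
      MvPolynomial.X RTree.bullet * forestMonomial k l) := by
  rw [growF_mk, treeSum_growList_node, add_comm]
  congr 2
  refine leibniz_eq_derivation k (A := fun l => forestSum k (PlanarTree.graftAux (.node []) l))
    (by simp [PlanarTree.graftAux, forestSum]) (forestSum_graftAux_cons k) (ND k) (fun a => ?_) l
  rw [ND, MvPolynomial.mkDerivation_X, growF_mk]

theorem mk_eq_bullet_iff {a : PlanarTree} : RTree.mk a = RTree.bullet ↔ a = .node [] := by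
  refine ⟨fun h => ?_, fun h => h ▸ rfl⟩
  cases a with
  | node l => simpa using PlanarTree.map_mk_perm_of_mk_eq h

theorem pruneAux_cons (a : PlanarTree) (l : List PlanarTree) : PlanarTree.pruneAux (a :: l) =
    (if a = .node [] then [l] else []) ++ (a.pruneList.map (· :: l)) ++
      (PlanarTree.pruneAux l).map (a :: ·) := by
  obtain ⟨_ | _⟩ := a <;> simp [PlanarTree.pruneAux]

theorem forestSum_pruneAux_cons (a : PlanarTree) (l : List PlanarTree) :
    forestSum k (PlanarTree.pruneAux (a :: l)) =
      ((if RTree.mk a = RTree.bullet then 1 else 0) + toHK k (treeSum k a.pruneList)) *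
        forestMonomial k l + MvPolynomial.X (RTree.mk a) * forestSum k (PlanarTree.pruneAux l) := by
  rw [pruneAux_cons, forestSum_append, forestSum_append, toHK_treeSum_mul,
    forestSum_map_cons, add_mul]
  simp only [mk_eq_bullet_iff]
  split_ifs <;> simp [forestSum]

theorem treeSum_pruneList_node (l : List PlanarTree) :
    treeSum k (PlanarTree.node l).pruneList =
      bplusLinear k (forestSum k (PlanarTree.pruneAux l)) := by
  rw [PlanarTree.pruneList, bplusLinear_forestSum]

theorem pruneF_mk (p : PlanarTree) : pruneF k (RTree.mk p) = treeSum k p.pruneList := by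
  refine PlanarTree.invariant_of_perm (fun p => treeSum k p.pruneList) (fun l l' h => ?_)
    (RTree.mk_rep (RTree.mk p))
  have hA := leibniz_perm k (A := fun l => forestSum k (PlanarTree.pruneAux l))
    (by simp [PlanarTree.pruneAux, forestSum]) (forestSum_pruneAux_cons k)
    (by simpa [Function.comp_def] using h.map fun x : RTree × (RTree →₀ k) =>
      (x.1, (if x.1 = RTree.bullet then 1 else 0) + toHK k x.2))
  simp only [treeSum_pruneList_node, hA]

theorem pruneF_bullet : pruneF k RTree.bullet = 0 := by
  simp [RTree.bullet, pruneF_mk, PlanarTree.pruneList, PlanarTree.pruneAux, treeSum]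

theorem PD_X (T : RTree) : PD k (MvPolynomial.X T) =
    (if T = RTree.bullet then 1 else 0) + toHK k (pruneF k T) := by
  rw [PD, MvPolynomial.mkDerivation_X]
  split_ifs with h
  · simp [h, pruneF_bullet]
  · simp

theorem pruneF_mk_node (l : List PlanarTree) :
    pruneF k (RTree.mk (.node l)) = bplusLinear k (PD k (forestMonomial k l)) := by
  rw [pruneF_mk, treeSum_pruneList_node]
  congr 1
  refine leibniz_eq_derivation k (A := fun l => forestSum k (PlanarTree.pruneAux l))
    (by simp [PlanarTree.pruneAux, forestSum]) (forestSum_pruneAux_cons k) (PD k) (fun a => ?_) l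
  rw [PD_X, pruneF_mk]

/-- The inner product on `H_K` as a bilinear form. -/
noncomputable def innerForm : HK k →ₗ[k] HK k →ₗ[k] k :=
  Finsupp.linearCombination k (fun d => ((forestTree d).sg : k) • MvPolynomial.lcoeff k d) ∘ₗ
    (MvPolynomial.basisMonomials RTree k).repr.toLinearMap

theorem innerHK_eq_innerForm (u v : HK k) : innerHK k u v = innerForm k u v := by
  rw [innerHK, innerT, Bplus_eq, Bplus_eq]
  change (Finsupp.mapDomain forestTree ((MvPolynomial.basisMonomials RTree k).repr u)).sum _ = _
  rw [Finsupp.sum_mapDomain_index_inj forestTree_injective]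
  simp only [bplusLinear_apply_forestTree, innerForm, LinearMap.comp_apply,
    LinearEquiv.coe_coe, Finsupp.linearCombination_apply]
  rw [Finsupp.sum, Finsupp.sum, LinearMap.sum_apply]
  refine Finset.sum_congr rfl fun d _ => ?_
  rw [LinearMap.smul_apply, LinearMap.smul_apply, smul_eq_mul, smul_eq_mul, mul_assoc]
  exact congrArg _ (mul_comm _ _)

theorem innerForm_monomial_left (d : RTree →₀ ℕ) (a : k) (v : HK k) :
    innerForm k (MvPolynomial.monomial d a) v =
      a * (((forestTree d).sg : k) * MvPolynomial.coeff d v) := by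
  simp [innerForm, basisMonomials_repr_monomial]

theorem innerForm_X_mul (T : RTree) (u v : HK k) :
    innerForm k (MvPolynomial.X T * u) v =
      (T.sg : k) * innerForm k u (MvPolynomial.pderiv T v) := by
  induction u using MvPolynomial.induction_on' with
  | add u u' hu hu' =>
    rw [mul_add, map_add, map_add, LinearMap.add_apply, LinearMap.add_apply, hu, hu', mul_add]
  | monomial d a =>
    rw [mul_comm, MvPolynomial.X, MvPolynomial.monomial_mul, mul_one, innerForm_monomial_left,
      innerForm_monomial_left, MvPolynomial.coeff_pderiv, sg_forestTree_add_single]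
    push_cast
    ring

theorem innerForm_forestMonomial_left (l : List PlanarTree) (v : HK k) :
    innerForm k (forestMonomial k l) v =
      bplusLinear k v (RTree.mk (.node l)) * ((RTree.mk (.node l)).sg : k) := by
  rw [← innerHK_eq_innerForm, innerHK, Bplus_eq, Bplus_eq, bplusLinear_forestMonomial, innerT,
    Finsupp.sum_single_index] <;> simp

theorem innerForm_forestMonomial_right (l : List PlanarTree) (u : HK k) :
    innerForm k u (forestMonomial k l) =
      bplusLinear k u (RTree.mk (.node l)) * ((RTree.mk (.node l)).sg : k) := by
  rw [← innerHK_eq_innerForm, innerHK, Bplus_eq, Bplus_eq, bplusLinear_forestMonomial, innerT]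
  rw [Finsupp.sum, Finset.sum_eq_single (RTree.mk (.node l))]
  · simp
  · intro T _ hT
    simp [Finsupp.single_eq_of_ne hT]
  · intro h
    simp [Finsupp.notMem_support_iff.mp h]

theorem pderiv_toHK (T : RTree) (f : RTree →₀ k) :
    MvPolynomial.pderiv T (toHK k f) = MvPolynomial.C (f T) := by
  induction f using Finsupp.induction_linear with
  | zero => simp
  | add f g hf hg => simp [hf, hg]
  | single S a =>
    simp only [toHK, Finsupp.linearCombination_single, Derivation.map_smul,
      MvPolynomial.pderiv_X, Pi.single_apply, Finsupp.single_apply]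
    split_ifs <;> simp_all [MvPolynomial.smul_eq_C_mul]

theorem sg_smul_lie_pderiv_PD (T : RTree)
    (hT : ∀ S, growF k T S * (S.sg : k) = pruneF k S T * (T.sg : k)) :
    (T.sg : k) • ⁅(MvPolynomial.pderiv T : Derivation k (HK k) (HK k)), PD k⁆ =
      (growF k T).sum fun S c => (c * (S.sg : k)) • MvPolynomial.pderiv S := by
  refine MvPolynomial.derivation_ext fun R => ?_
  have hR : PD k (MvPolynomial.pderiv T (MvPolynomial.X R)) = 0 := by
    rw [MvPolynomial.pderiv_X, Pi.single_apply]
    split_ifs <;> simp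
  have hsum : ((growF k T).sum fun S c =>
      (c * (S.sg : k)) • (MvPolynomial.pderiv S : Derivation k (HK k) (HK k)))
        (MvPolynomial.X R) = MvPolynomial.C (growF k T R * (R.sg : k)) := by
    rw [Finsupp.sum, ← Derivation.coeFnAddMonoidHom_apply, map_sum, Finset.sum_apply,
      Finset.sum_eq_single R]
    · simp [MvPolynomial.smul_eq_C_mul]
    · intro S _ hS
      simp [MvPolynomial.pderiv_X_of_ne hS.symm]
    · intro h
      simp [Finsupp.notMem_support_iff.mp h]
  rw [hsum, hT, Derivation.smul_apply, Derivation.commutator_apply, hR, PD_X, map_add,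
    pderiv_toHK, sub_zero, mul_comm, MvPolynomial.C_mul, ← MvPolynomial.smul_eq_C_mul]
  congr 1
  split_ifs <;> simp

theorem innerForm_toHK_mul (f : RTree →₀ k) (u v : HK k) :
    innerForm k (toHK k f * u) v = innerForm k u
      ((f.sum fun S c => (c * (S.sg : k)) •
        (MvPolynomial.pderiv S : Derivation k (HK k) (HK k))) v) := by
  rw [toHK, Finsupp.linearCombination_apply, Finsupp.sum, Finsupp.sum, Finset.sum_mul, map_sum,
    LinearMap.sum_apply, ← Derivation.coeFnAddMonoidHom_apply, map_sum, Finset.sum_apply, map_sum]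
  refine Finset.sum_congr rfl fun S _ => ?_
  simp [innerForm_X_mul, mul_assoc]

theorem innerForm_one_PD (v : HK k) :
    innerForm k 1 (MvPolynomial.pderiv RTree.bullet v) = innerForm k 1 (PD k v) := by
  have hinner : ∀ w : HK k, innerForm k 1 w = MvPolynomial.constantCoeff w := fun w => by
    have h := innerForm_monomial_left k 0 1 w
    have h0 : (forestTree 0).sg = 1 := by simp [sg_forestTree]
    rw [h0] at h
    simpa [MvPolynomial.constantCoeff_eq] using h
  have htoHK : ∀ f : RTree →₀ k, MvPolynomial.constantCoeff (toHK k f) = 0 := fun f => by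
    simp [toHK, Finsupp.linearCombination_apply, Finsupp.sum, MvPolynomial.smul_eq_C_mul]
  rw [hinner, hinner]
  induction v using MvPolynomial.induction_on with
  | C a => simp
  | add p q hp hq => simp [hp, hq]
  | mul_X p T hp =>
    simp only [Derivation.leibniz, smul_eq_mul, map_add, map_mul, hp, PD_X, htoHK,
      MvPolynomial.constantCoeff_X, MvPolynomial.pderiv_X, Pi.single_apply]
    split_ifs <;> simp_all

theorem innerForm_forestMonomial_adjoint (l : List PlanarTree)
    (hl : ∀ a ∈ l, ∀ S, growF k (RTree.mk a) S * (S.sg : k) =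
      pruneF k S (RTree.mk a) * ((RTree.mk a).sg : k)) (v : HK k) :
    innerForm k (ND k (forestMonomial k l) +
      MvPolynomial.X RTree.bullet * forestMonomial k l) v =
        innerForm k (forestMonomial k l) (PD k v) := by
  induction l generalizing v with
  | nil =>
    have h1 : forestMonomial k [] = 1 := rfl
    rw [h1, Derivation.map_one_eq_zero, zero_add, innerForm_X_mul, RTree.sg_bullet,
      innerForm_one_PD]
    simp
  | cons a l ih =>
    have ih := ih (fun b hb => hl b (List.mem_cons_of_mem a hb))
      (MvPolynomial.pderiv (RTree.mk a) v)
    have hsplit : ND k (forestMonomial k (a :: l)) +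
        MvPolynomial.X RTree.bullet * forestMonomial k (a :: l) =
          MvPolynomial.X (RTree.mk a) * (ND k (forestMonomial k l) +
            MvPolynomial.X RTree.bullet * forestMonomial k l) +
          toHK k (growF k (RTree.mk a)) * forestMonomial k l := by
      rw [forestMonomial_cons, Derivation.leibniz, smul_eq_mul, smul_eq_mul, ND,
        MvPolynomial.mkDerivation_X]
      ring
    rw [hsplit, map_add, LinearMap.add_apply, innerForm_X_mul, ih, innerForm_toHK_mul,
      ← sg_smul_lie_pderiv_PD k _ (hl a List.mem_cons_self), forestMonomial_cons, innerForm_X_mul,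
      Derivation.smul_apply, Derivation.commutator_apply, map_smul, map_sub, smul_eq_mul]
    ring

theorem growF_mul_sg (T S : RTree) :
    growF k T S * (S.sg : k) = pruneF k S T * (T.sg : k) := by
  rw [← RTree.mk_rep T]
  generalize T.rep = p
  induction p using PlanarTree.induction_children generalizing S with
  | h l ih =>
    rw [← RTree.mk_rep S]
    obtain ⟨l'⟩ := S.rep
    rw [growF_mk_node, pruneF_mk_node, ← innerForm_forestMonomial_right k l',
      ← innerForm_forestMonomial_left k l]
    exact innerForm_forestMonomial_adjoint k l (fun a ha S => ih a ha S) _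

theorem monomial_eq_smul_forestMonomial (d : RTree →₀ ℕ) (a : k) :
    MvPolynomial.monomial d a = a • forestMonomial k
      (d.support.toList.flatMap fun T => List.replicate (d T) T.rep) := by
  rw [forestMonomial_eq_monomial, map_mk_branches, Finsupp.toMultiset_toFinsupp,
    MvPolynomial.smul_monomial, smul_eq_mul, mul_one]

end Adjoint

/-- With respect to the inner product on `H_K`, the adjoint of `P`
is `N + M_•`: `(N(u) + •·u, v) = (u, P(v))`. -/
theorem stmt15 (k : Type*) [Field k] [CharZero k] (u v : HK k) :
    innerHK k (ND k u + MvPolynomial.X RTree.bullet * u) v = innerHK k u (PD k v) := by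
  rw [innerHK_eq_innerForm, innerHK_eq_innerForm]
  induction u using MvPolynomial.induction_on' with
  | add p q hp hq =>
    rw [map_add (ND k), mul_add, add_add_add_comm, LinearMap.map_add₂, hp, hq, LinearMap.map_add₂]
  | monomial d a =>
    rw [monomial_eq_smul_forestMonomial, Derivation.map_smul, mul_smul_comm, ← smul_add, map_smul,
      map_smul, LinearMap.smul_apply, LinearMap.smul_apply,
      innerForm_forestMonomial_adjoint k _ fun a _ => growF_mul_sg k (RTree.mk a)]
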